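/- arXiv:1703.08039 — 2 statements merged into one kernel-verified Lean document; each statement's English description precedes it below -/
import Mathlib

section
/- If n > 2 is an integer and 2n is a G number, then there exist primes q and r such that 2n = q + r; specifically, q = p1(n) and r = g((n-1)^2, p1(n)) / p1(n) are both prime and sum to 2n. -/
/-- `g x m = x + 2m - ((x - m) mod 2m)`. -/
def g (x m : ℕ) : ℕ := x + 2 * m - (x - m) % (2 * m)

/-- `p1 n` is the maximum of the smallest prime factor of `g ((n-1)^2) p`
taken over all odd primes `p ≤ n`. -/
def p1 (n : ℕ) : ℕ :=
  ((Finset.range (n + 1)).filter (fun p => p.Prime ∧ Odd p)).sup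
    (fun p => Nat.minFac (g ((n - 1) ^ 2) p))

/-- The even number `2n` is a G number if `g ((n-1)^2) (p1 n) = p1 n * (2n - p1 n)`. -/
def IsGNumber (n : ℕ) : Prop :=
  g ((n - 1) ^ 2) (p1 n) = p1 n * (2 * n - p1 n)

lemma g_spec (x m : ℕ) (hm : 0 < m) (hx : m ≤ x) :
    ∃ t, g x m = m * (2 * t + 1) ∧ x < g x m ∧ g x m ≤ x + 2 * m := by
  have h1 := Nat.mod_add_div (x - m) (2 * m)
  have h2 := Nat.mod_lt (x - m) (show 0 < 2 * m by omega)
  refine ⟨(x - m) / (2 * m) + 1, ?_, ?_, ?_⟩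
  · unfold g
    have : m * (2 * ((x - m) / (2 * m) + 1) + 1) = 2 * m * ((x - m) / (2 * m)) + 3 * m := by ring
    omega
  · unfold g; omega
  · unfold g; omega

lemma aux (q d : ℕ) (hq3 : 3 ≤ q) (hdb : d ^ 2 + 2 ≤ 2 * d + 2 * q)
    (h : 3 * (q * (q + 2)) ≤ (q + d) ^ 2 + 1) : False := by
  have hdq : d ≤ q := by
    by_contra hlt
    push Not at hlt
    nlinarith only [hlt, hdb, hq3]
  have : q * d ≤ q * q := by gcongr
  nlinarith only [this, h, hdb, hdq, hq3]

set_option maxHeartbeats 1000000 in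
theorem stmt_6 (n : ℕ) (hn : 2 < n) (hG : IsGNumber n) :
    ∃ q r : ℕ, Nat.Prime q ∧ Nat.Prime r ∧ 2 * n = q + r ∧
      q = p1 n ∧ r = g ((n - 1) ^ 2) (p1 n) / p1 n := by
  have hpn : ∀ p ≤ n, p ≤ (n - 1) ^ 2 := by
    intro p hp
    obtain ⟨a, rfl⟩ : ∃ a, n = a + 3 := ⟨n - 3, by omega⟩
    have : a + 3 - 1 = a + 2 := by omega
    rw [this]; nlinarith
  have hne : ((Finset.range (n + 1)).filter (fun p => p.Prime ∧ Odd p)).Nonempty :=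
    ⟨3, by
      simp only [Finset.mem_filter, Finset.mem_range]
      exact ⟨by omega, by norm_num, by decide⟩⟩
  obtain ⟨p, hp, hpe⟩ := Finset.exists_mem_eq_sup _ hne
    (fun p => Nat.minFac (g ((n - 1) ^ 2) p))
  change p1 n = _ at hpe
  simp only [Finset.mem_filter, Finset.mem_range] at hp
  obtain ⟨hpn1, hpp, hpo⟩ := hp
  have h6 : n = 6 → p1 n ≠ 3 := by
    rintro rfl h
    have h5 : 5 ∈ ((Finset.range (6 + 1)).filter (fun p => p.Prime ∧ Odd p)) := by
      simp only [Finset.mem_filter, Finset.mem_range]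
      exact ⟨by omega, by norm_num, by decide⟩
    have := Finset.le_sup (f := fun p => Nat.minFac (g ((6 - 1) ^ 2) p)) h5
    change _ ≤ p1 6 at this
    rw [h] at this
    norm_num [g] at this
  unfold IsGNumber at hG
  generalize p1 n = q at *
  obtain ⟨t, hgt, hg1, hg2⟩ := g_spec _ p hpp.pos (hpn p (by omega))
  have hgo : Odd (g ((n - 1) ^ 2) p) := by
    rw [hgt]; exact hpo.mul ⟨t, rfl⟩
  have hg0 : g ((n - 1) ^ 2) p ≠ 1 := by
    have := hpn p (by omega)
    have := hpp.two_le
    omega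
  have hq : q.Prime := by rw [hpe]; exact Nat.minFac_prime hg0
  have hqd : q ∣ g ((n - 1) ^ 2) p := by rw [hpe]; exact Nat.minFac_dvd _
  have hqo : Odd q := hgo.of_dvd_nat hqd
  have hqp : q ≤ p := by
    rw [hpe]; exact Nat.minFac_le_of_dvd hpp.two_le (by rw [hgt]; exact dvd_mul_right _ _)
  have hq3 : 3 ≤ q := by
    have := hq.two_le
    obtain ⟨a, ha⟩ := hqo
    omega
  obtain ⟨s, hqs, hq1, hq2⟩ := g_spec _ q hq.pos (hpn q (by omega))
  obtain ⟨d, hd⟩ : ∃ d, n = q + d := ⟨n - q, by omega⟩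
  have hr : 2 * n - q = q + 2 * d := by omega
  rw [hr] at hG
  have hdb : d ^ 2 + 2 ≤ 2 * d + 2 * q := by
    rw [hG] at hq1
    obtain ⟨a, ha⟩ : ∃ a, n = a + 1 := ⟨n - 1, by omega⟩
    have h1 : n - 1 = a := by omega
    rw [h1] at hq1
    have h2 : a + 1 = q + d := by omega
    have h3 : (a + 1) ^ 2 = (q + d) ^ 2 := by rw [h2]
    nlinarith only [h2, h3, hq1]
  have hpq : p = q := by
    by_contra hne'
    have hpq : q + 2 ≤ p := by
      obtain ⟨a, ha⟩ := hqo
      obtain ⟨b, hb⟩ := hpo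
      omega
    have hqk : q ∣ 2 * t + 1 := by
      rw [hgt] at hqd
      rcases hq.dvd_mul.1 hqd with h | h
      · exact absurd ((Nat.prime_dvd_prime_iff_eq hq hpp).1 h).symm hne'
      · exact h
    obtain ⟨c, hc⟩ := hqk
    rw [hgt, hc] at hg1 hg2
    obtain ⟨a, ha⟩ : ∃ a, n = a + 1 := ⟨n - 1, by omega⟩
    have h1 : n - 1 = a := by omega
    rw [h1] at hg1 hg2
    have hco : Odd c := Odd.of_dvd_nat (⟨t, rfl⟩ : Odd (2 * t + 1)) (by rw [hc]; exact dvd_mul_left _ _)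
    have hc1 : c ≠ 1 := by
      rintro rfl
      have h3 : q + 1 ≤ a := by omega
      have h4 : p ≤ a + 1 := by omega
      nlinarith
    have hc3 : 3 ≤ c := by
      obtain ⟨b, hb⟩ := hco
      omega
    have h5 : p * (q * 3) ≤ p * (q * c) := by gcongr
    have h6 : 3 * (q * (q + 2)) ≤ a ^ 2 + 2 * (a + 1) := by
      have : (q + 2) * (3 * q) ≤ p * (3 * q) := by gcongr
      nlinarith
    have h7 : a + 1 = q + d := by omega
    have h8 : a ^ 2 + 2 * (a + 1) = (q + d) ^ 2 + 1 := by rw [← h7]; ring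
    exact aux q d hq3 hdb (by omega)
  subst hpq
  have hrp : (p + 2 * d).Prime := by
    by_contra hnp
    have hmf : p ≤ (p + 2 * d).minFac := by
      have : (g ((n - 1) ^ 2) p).minFac ≤ (p + 2 * d).minFac := by
        apply Nat.minFac_le_of_dvd (Nat.minFac_prime (by omega)).two_le
        rw [hG]
        exact (Nat.minFac_dvd _).trans (dvd_mul_left _ _)
      omega
    have h1 := Nat.minFac_sq_le_self (by omega) hnp
    have h2 : p ^ 2 ≤ p + 2 * d := le_trans (Nat.pow_le_pow_left hmf 2) h1
    have hp4 : p < 4 := by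
      by_contra hlt
      push Not at hlt
      have h3 : p ≤ d := by nlinarith only [hlt, h2]
      have h4 : 4 * d ≤ d * d := by
        have : 4 ≤ d := by omega
        gcongr
      nlinarith only [h3, h4, hdb]
    have hp3 : p = 3 := by omega
    subst hp3
    have hd4 : d < 4 := by
      by_contra hlt
      push Not at hlt
      nlinarith only [hlt, hdb]
    have : d = 3 := by omega
    exact h6 (by omega) rfl
  refine ⟨p, p + 2 * d, hpp, hrp, by omega, rfl, ?_⟩
  rw [hG, Nat.mul_div_cancel_left _ hpp.pos]
end

section
/- If n > 2 is a prime number, then p1(n) = n. -/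
theorem stmt_9 (n : ℕ) (hn : 2 < n) (hp : Nat.Prime n) : p1 n = n := by
  apply le_antisymm
  · unfold p1
    apply Finset.sup_le
    intro p h
    simp only [Finset.mem_filter, Finset.mem_range] at h
    obtain ⟨h1, h2, -⟩ := h
    obtain ⟨k, rfl⟩ : ∃ k, n = k + 3 := ⟨n - 3, by omega⟩
    have hx : p ≤ (k + 3 - 1) ^ 2 := by
      have : k + 3 - 1 = k + 2 := by omega
      rw [this]; nlinarith
    have hd : p ∣ g ((k + 3 - 1) ^ 2) p := by
      unfold g
      generalize (k + 3 - 1) ^ 2 = x at hx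
      obtain ⟨y, rfl⟩ := Nat.exists_eq_add_of_le hx
      rw [Nat.add_sub_cancel_left]
      have e := Nat.div_add_mod y (2 * p)
      refine ⟨2 * (y / (2 * p)) + 3, ?_⟩
      have e2 : p * (2 * (y / (2 * p)) + 3) = 2 * p * (y / (2 * p)) + 3 * p := by ring
      rw [e2]
      omega
    exact (Nat.minFac_le_of_dvd h2.two_le hd).trans (by omega)
  · have ho : Odd n := hp.odd_of_ne_two (by omega)
    have hg : g ((n - 1) ^ 2) n = n ^ 2 := by
      obtain ⟨k, rfl⟩ := ho
      obtain ⟨j, rfl⟩ : ∃ j, k = j + 1 := ⟨k - 1, by omega⟩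
      unfold g
      have e1 : 2 * (j + 1) + 1 - 1 = 2 * (j + 1) := by omega
      have e2 : (2 * (j + 1)) ^ 2 = (2 * (j + 1) + 1) + (1 + 2 * (2 * (j + 1) + 1) * j) := by ring
      rw [e1]
      have e3 : ((2 * (j + 1)) ^ 2 - (2 * (j + 1) + 1)) % (2 * (2 * (j + 1) + 1)) = 1 := by
        rw [e2, Nat.add_sub_cancel_left, Nat.add_mul_mod_self_left]
        exact Nat.mod_eq_of_lt (by omega)
      rw [e3]
      have : (2 * (j + 1) + 1) ^ 2 = (2 * (j + 1)) ^ 2 + (2 * (2 * (j + 1)) + 1) := by ring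
      omega
    have hm : Nat.minFac (g ((n - 1) ^ 2) n) = n := by
      rw [hg, Nat.pow_minFac (by norm_num), hp.minFac_eq]
    have := Finset.le_sup (s := (Finset.range (n + 1)).filter (fun p => p.Prime ∧ Odd p))
      (f := fun p => Nat.minFac (g ((n - 1) ^ 2) p)) (b := n) (by simp [hp, ho])
    simp only [hm] at this
    exact this
end
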